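/- Let G be a countable group such that for every ε' > 0 and every finite K' ⊆ G there exists a finite (K', ε')-invariant subset of G (i.e., G is amenable). Let 0 < ε < 1 and 0 < δ < ε³/250. Suppose G acts non-singularly and setwise freely on a probability space (X, 𝓕, μ), and K ⊆ G is finite, symmetric, and contains the identity. If 𝒯 = {T₁, …, T_ℓ} is a tiling family for G whose shapes are all (K, δ)-invariant, then for each T ∈ 𝒯 there exists a measurable T-set W_T ⊆ X such that (1) for distinct T₁, T₂ ∈ 𝒯, μ(T₁W_{T₁} ∩ T₂W_{T₂}) = 0; (2) μ(⋃_{T∈𝒯} TW_T) > 1 − ε; and (3) ∑_{T∈𝒯} μ((∂_K T)W_T) < ε. -/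

import Mathlib

open MeasureTheory
open scoped Pointwise ENNReal
open MeasureTheory
open scoped Pointwise ENNReal

/-- The *`K`-boundary* of `H`: the set of `g ∈ G` such that `Kg` meets both `H` and its
complement. -/
def kBoundary {G : Type*} [Group G] (K H : Set G) : Set G :=
  {g : G | (∃ k ∈ K, k * g ∈ H) ∧ ∃ k ∈ K, k * g ∉ H}

/-- A finite set `H ⊆ G` is *`(K, ε)`-invariant* if its `K`-boundary has fewer than `ε * |H|`
elements. -/
def KInvariant {G : Type*} [Group G] (K : Finset G) (ε : ℝ) (H : Finset G) : Prop :=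
  ((kBoundary (K : Set G) (H : Set G)).ncard : ℝ) < ε * H.card

/-- A finite subset `T` *tiles* `G` if there is a set of centres `C` such that the right
translates `Tc`, `c ∈ C`, partition `G`. -/
def IsTile {G : Type*} [Group G] (T : Finset G) : Prop :=
  ∃ C : Set G,
    (C.PairwiseDisjoint fun c => (fun t => t * c) '' (T : Set G)) ∧
    (⋃ c ∈ C, (fun t => t * c) '' (T : Set G)) = Set.univ

/-- An action of `G` on a measure space is *setwise free* if for every `g ≠ 1` and every
measurable set `A` of positive measure there is a positive-measure measurable `B ⊆ A` with
`μ (gB ∆ B) > 0`. -/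
def SetwiseFree (G : Type*) {X : Type*} [Group G] [MulAction G X] [MeasurableSpace X]
    (μ : Measure X) : Prop :=
  ∀ g : G, g ≠ 1 → ∀ A : Set X, MeasurableSet A → 0 < μ A →
    ∃ B : Set X, B ⊆ A ∧ MeasurableSet B ∧ 0 < μ B ∧ 0 < μ (symmDiff (g • B) B)

/-- A measurable action is *non-singular* if each group element acts measurably and
preserves nullity of measurable sets. -/
def NonSingularAction (G : Type*) {X : Type*} [Group G] [MulAction G X] [MeasurableSpace X]
    (μ : Measure X) : Prop :=
  (∀ g : G, Measurable fun x : X => g • x) ∧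
  ∀ (g : G) (A : Set X), MeasurableSet A → (μ A = 0 ↔ μ (g⁻¹ • A) = 0)

/-- A set `W` is an *`H`-set* if its images under distinct elements of `H` are almost
disjoint. -/
def IsHSet {G X : Type*} [Group G] [MulAction G X] [MeasurableSpace X]
    (μ : Measure X) (H : Set G) (W : Set X) : Prop :=
  ∀ h ∈ H, ∀ h' ∈ H, h ≠ h' → μ ((h • W) ∩ (h' • W)) = 0


/-- A finite family `𝒯` of finite subsets of `G` is a *tiling family* if there are centre sets
`C T` (for `T ∈ 𝒯`) such that the translates `Tc`, `c ∈ C T`, `T ∈ 𝒯`, partition `G`. -/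
def IsTilingFamily {G : Type*} [Group G] (𝒯 : Finset (Finset G)) (C : Finset G → Set G) :
    Prop :=
  (∀ T ∈ 𝒯, ∀ c ∈ C T, ∀ T' ∈ 𝒯, ∀ c' ∈ C T', (T, c) ≠ (T', c') →
    Disjoint ((fun t => t * c) '' (T : Set G)) ((fun t => t * c') '' (T' : Set G))) ∧
  (⋃ T ∈ 𝒯, ⋃ c ∈ C T, (fun t => t * c) '' (T : Set G)) = Set.univ

section Towers

variable {G X : Type*} [Group G] [MulAction G X] [MeasurableSpace X] {μ : Measure X}

lemma exists_subset_disjoint_smul [MeasurableConstSMul G X]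
    (hnull : ∀ (g : G) (A : Set X), MeasurableSet A → (μ (g • A) = 0 ↔ μ A = 0))
    (hfree : SetwiseFree G μ) {g : G} (hg : g ≠ 1) {A : Set X} (hA : MeasurableSet A)
    (hpos : 0 < μ A) :
    ∃ B ⊆ A, MeasurableSet B ∧ 0 < μ B ∧ Disjoint (g • B) B := by
  obtain ⟨B, hBA, hB, -, hd⟩ := hfree g hg A hA hpos
  by_cases h : μ (B \ g • B) = 0
  · refine ⟨B \ g⁻¹ • B, Set.sdiff_subset.trans hBA, hB.diff (hB.const_smul _), ?_, ?_⟩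
    · refine pos_iff_ne_zero.2 fun h0 => hd.ne' ?_
      rw [← hnull g _ (hB.diff (hB.const_smul _)), Set.smul_set_sdiff, smul_inv_smul] at h0
      exact measure_union_null h0 h
    · rw [Set.smul_set_sdiff, smul_inv_smul]
      exact Set.disjoint_left.2 fun x hx hx' => hx.2 hx'.1
  · refine ⟨B \ g • B, Set.sdiff_subset.trans hBA, hB.diff (hB.const_smul _),
      pos_iff_ne_zero.2 h, ?_⟩
    exact Set.disjoint_left.2 fun x hx hx' =>
      hx'.2 (Set.smul_set_mono Set.sdiff_subset hx)

lemma exists_subset_forall_disjoint_smul [MeasurableConstSMul G X]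
    (hnull : ∀ (g : G) (A : Set X), MeasurableSet A → (μ (g • A) = 0 ↔ μ A = 0))
    (hfree : SetwiseFree G μ) (P : Finset G) (hP : (1 : G) ∉ P) {A : Set X}
    (hA : MeasurableSet A) (hpos : 0 < μ A) :
    ∃ B ⊆ A, MeasurableSet B ∧ 0 < μ B ∧ ∀ g ∈ P, Disjoint (g • B) B := by
  classical
  induction P using Finset.induction_on with
  | empty => exact ⟨A, subset_rfl, hA, hpos, by simp⟩
  | insert g P _ ih =>
    rw [Finset.mem_insert, not_or] at hP
    obtain ⟨B, hBA, hB, hBpos, hdisj⟩ := ih hP.2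
    obtain ⟨B', hBB, hB', hBpos', hdisj'⟩ :=
      exists_subset_disjoint_smul hnull hfree (Ne.symm hP.1) hB hBpos
    refine ⟨B', hBB.trans hBA, hB', hBpos', fun h hh => ?_⟩
    rcases Finset.mem_insert.1 hh with rfl | hh
    · exact hdisj'
    · exact (hdisj h hh).mono (Set.smul_set_mono hBB) hBB

lemma exists_subset_pairwiseDisjoint_smul [MeasurableConstSMul G X]
    (hnull : ∀ (g : G) (A : Set X), MeasurableSet A → (μ (g • A) = 0 ↔ μ A = 0))
    (hfree : SetwiseFree G μ) (E : Finset G) {A : Set X} (hA : MeasurableSet A)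
    (hpos : 0 < μ A) :
    ∃ B ⊆ A, MeasurableSet B ∧ 0 < μ B ∧ (E : Set G).PairwiseDisjoint (fun h => h • B) := by
  classical
  obtain ⟨B, hBA, hB, hBpos, h⟩ := exists_subset_forall_disjoint_smul hnull hfree
    ((E⁻¹ * E).erase 1) (Finset.notMem_erase _ _) hA hpos
  refine ⟨B, hBA, hB, hBpos, fun a ha b hb hab => ?_⟩
  have := h (b⁻¹ * a) (Finset.mem_erase.2 ⟨fun h => hab (inv_mul_eq_one.1 h).symm,
    Finset.mul_mem_mul (Finset.inv_mem_inv hb) ha⟩)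
  rw [mul_smul] at this
  simpa using (Set.disjoint_smul_set (a := b)).2 this

lemma card_mul_sdiff_lt [DecidableEq G] {S F : Finset G} (hSinv : ∀ s ∈ S, s⁻¹ ∈ S)
    (hSone : (1 : G) ∈ S) {ε : ℝ} (hF : KInvariant S ε F) :
    (((S * F) \ F).card : ℝ) < ε * F.card := by
  refine lt_of_le_of_lt ?_ hF
  rw [Nat.cast_le, ← Set.ncard_coe_finset]
  refine Set.ncard_le_ncard ?_ ?_
  · intro g hg
    simp only [Finset.coe_sdiff, Set.mem_sdiff, Finset.mem_coe, Finset.mem_mul] at hg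
    obtain ⟨⟨s, hs, f, hf, rfl⟩, hg⟩ := hg
    exact ⟨⟨s⁻¹, hSinv s hs, by simpa using hf⟩, 1, hSone, by simpa using hg⟩
  · refine (S⁻¹ * F).finite_toSet.subset ?_
    rintro g ⟨⟨k, hk, hkg⟩, -⟩
    exact Finset.mem_mul.2 ⟨k⁻¹, Finset.inv_mem_inv hk, k * g, hkg, by simp⟩

/-- A tower `H • V` inside `A`, separated by `S`, whose `S`-neighbourhood in `A` has measure at
most `η` times that of the tower. -/
structure IsTowerIn (μ : Measure X) (S : Finset G) (η : ℝ≥0∞) (A : Set X) (H : Finset G)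
    (V : Set X) : Prop where
  measurableSet : MeasurableSet V
  subset : (H : Set G) • V ⊆ A
  pairwiseDisjoint : ((S : Set G) * (H : Set G)).PairwiseDisjoint (fun h => h • V)
  measure_le : μ (((S : Set G) • (H : Set G) • V \ (H : Set G) • V) ∩ A) ≤
    η * μ ((H : Set G) • V)

lemma measurableSet_finset_smul [MeasurableConstSMul G X] (H : Finset G) {V : Set X}
    (hV : MeasurableSet V) : MeasurableSet ((H : Set G) • V) := by
  rw [← Set.iUnion_smul_set]
  exact H.measurableSet_biUnion fun h _ => hV.const_smul h

lemma measure_finset_smul [MeasurableConstSMul G X] {H : Finset G} {V : Set X}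
    (hV : MeasurableSet V) (hd : (H : Set G).PairwiseDisjoint (fun h => h • V)) :
    μ ((H : Set G) • V) = ∑ h ∈ H, μ (h • V) := by
  rw [← Set.iUnion_smul_set]
  exact measure_biUnion_finset hd fun h _ => hV.const_smul h

/-- Along a Følner set `F`, the translates of `A` witness a set on which the boundary weight is
dominated by the interior weight. -/
lemma exists_measurableSet_sum_measure_le [MeasurableConstSMul G X] [IsFiniteMeasure μ]
    (E F : Finset G) {c : ℝ≥0∞} (hc : c ≠ ∞) {A : Set X}
    (hpos : 0 < μ A) (hcard : (E.card : ℝ≥0∞) < c * F.card) :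
    ∃ Y, MeasurableSet Y ∧ (∃ f ∈ F, 0 < μ ((f • Y) ∩ A)) ∧ ∀ V, MeasurableSet V → V ⊆ Y →
      ∑ f ∈ E, μ ((f • V) ∩ A) ≤ c * ∑ f ∈ F, μ ((f • V) ∩ A) := by
  let ν : Finset G → Measure X := fun P => ∑ f ∈ P, (μ.restrict A).map (fun x => f⁻¹ • x)
  have hν : ∀ P V, MeasurableSet V → ν P V = ∑ f ∈ P, μ ((f • V) ∩ A) := by
    intro P V hV
    simp only [ν, Measure.finsetSum_apply]
    refine Finset.sum_congr rfl fun f _ => ?_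
    rw [Measure.map_apply (measurable_const_smul _) hV, Set.preimage_smul, inv_inv,
      Measure.restrict_apply (hV.const_smul f)]
  have hνuniv : ∀ P, ν P Set.univ = P.card * μ A := by
    intro P
    rw [hν P _ MeasurableSet.univ]
    simp
  have hfin : ∀ P, IsFiniteMeasure (ν P) := fun P =>
    ⟨by rw [hνuniv]; exact ENNReal.mul_lt_top (by simp) (measure_lt_top _ _)⟩
  have hfin' : IsFiniteMeasure (c • ν F) := by
    have := hfin F
    exact Measure.smul_finite _ hc
  have := hfin E
  obtain ⟨Y, hY, hle, hge⟩ := hahn_decomposition (c • ν F) (ν E)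
  simp only [Measure.smul_apply, smul_eq_mul] at hle hge
  refine ⟨Y, hY, ?_, fun V hV hVY => ?_⟩
  · by_contra! h
    have h0 : ν F Y = 0 := by
      rw [hν F Y hY]
      exact Finset.sum_eq_zero fun f hf => nonpos_iff_eq_zero.1 (h f hf)
    have h1 : ν F Yᶜ = ν F Set.univ := by
      rw [← measure_add_measure_compl (μ := ν F) hY, h0, zero_add]
    have h2 := (hge Yᶜ hY.compl subset_rfl).trans (measure_mono (Set.subset_univ _))
    rw [h1, hνuniv, hνuniv, ← mul_assoc] at h2
    exact absurd h2 (not_le.2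
      (ENNReal.mul_lt_mul_left hpos.ne' (measure_ne_top _ _) hcard))
  · simpa only [hν _ V hV] using hle V hV hVY

lemma exists_isTowerIn [MeasurableConstSMul G X] [IsFiniteMeasure μ]
    (hamen : ∀ ε' : ℝ, 0 < ε' → ∀ K' : Finset G, ∃ H : Finset G, KInvariant K' ε' H)
    (hnull : ∀ (g : G) (A : Set X), MeasurableSet A → (μ (g • A) = 0 ↔ μ A = 0))
    (hfree : SetwiseFree G μ) {S : Finset G} (hSinv : ∀ s ∈ S, s⁻¹ ∈ S) (hSone : (1 : G) ∈ S)
    {η : ℝ} (hη : 0 < η) {A : Set X} (hA : MeasurableSet A) (hpos : 0 < μ A) :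
    ∃ (H : Finset G) (V : Set X), MeasurableSet V ∧ (H : Set G) • V ⊆ A ∧
      ((S : Set G) * (H : Set G)).PairwiseDisjoint (fun h => h • V) ∧
      0 < μ ((H : Set G) • V) ∧
      μ (((S : Set G) • (H : Set G) • V \ (H : Set G) • V) ∩ A) <
        ENNReal.ofReal η * μ ((H : Set G) • V) := by
  classical
  obtain ⟨F, hF⟩ := hamen (η / 2) (half_pos hη) S
  have hcard : (((S * F) \ F).card : ℝ≥0∞) < ENNReal.ofReal (η / 2) * F.card := by
    have := card_mul_sdiff_lt hSinv hSone hF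
    rw [← ENNReal.ofReal_natCast, ← ENNReal.ofReal_natCast, ← ENNReal.ofReal_mul (by positivity)]
    exact (ENNReal.ofReal_lt_ofReal_iff_of_nonneg (by positivity)).2 this
  obtain ⟨Y, hY, ⟨f₀, hf₀, hf₀pos⟩, hYle⟩ :=
    exists_measurableSet_sum_measure_le _ _ ENNReal.ofReal_ne_top hpos hcard
  obtain ⟨V₁, hV₁Y, hV₁, hV₁pos, hV₁d⟩ := exists_subset_pairwiseDisjoint_smul hnull hfree (S * F)
    (hY.inter (hA.const_smul f₀⁻¹)) (by
      rw [pos_iff_ne_zero, ne_eq, ← hnull f₀ _ (hY.inter (hA.const_smul f₀⁻¹)),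
        Set.smul_set_inter, smul_inv_smul]
      exact hf₀pos.ne')
  let Z : Finset G → Set X := fun P =>
    V₁ ∩ ((⋂ f ∈ P, f⁻¹ • A) ∩ ⋂ f ∈ F \ P, (f⁻¹ • A)ᶜ)
  have hZ : ∀ P, MeasurableSet (Z P) := fun P => hV₁.inter
    ((Finset.measurableSet_biInter _ fun f _ => hA.const_smul _).inter
      (Finset.measurableSet_biInter _ fun f _ => (hA.const_smul _).compl))
  obtain ⟨P, hPF, hPpos⟩ : ∃ P ⊆ F, 0 < μ (Z P) := by
    by_contra! h
    refine hV₁pos.ne' (measure_mono_null (t := ⋃ P ∈ F.powerset, Z P) ?_ ?_)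
    · intro x hx
      refine Set.mem_biUnion (x := F.filter fun f => x ∈ f⁻¹ • A)
        (Finset.mem_powerset.2 (Finset.filter_subset _ _)) ⟨hx, ?_, ?_⟩
      · simp +contextual
      · simp +contextual
    · refine (measure_biUnion_null_iff F.powerset.countable_toSet).2 fun P hP => ?_
      exact nonpos_iff_eq_zero.1 (h P (Finset.mem_powerset.1 hP))
  have hin : ∀ f ∈ P, f • Z P ⊆ A := by
    intro f hf
    rw [Set.smul_set_subset_iff_subset_inv_smul_set]
    exact fun x hx => Set.mem_iInter₂.1 hx.2.1 f hf
  have hout : ∀ f ∈ F, f ∉ P → f • Z P ∩ A = ∅ := by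
    rintro f hf hfP
    refine Set.eq_empty_of_forall_notMem ?_
    rintro _ ⟨⟨x, hx, rfl⟩, hxA⟩
    refine Set.mem_iInter₂.1 hx.2.2 f (Finset.mem_sdiff.2 ⟨hf, hfP⟩) ?_
    rwa [Set.mem_smul_set_iff_inv_smul_mem, inv_inv]
  have hf₀P : f₀ ∈ P := by
    by_contra hf₀P
    obtain ⟨x, hx⟩ := nonempty_of_measure_ne_zero hPpos.ne'
    have hxA := (hV₁Y hx.1).2
    rw [Set.mem_smul_set_iff_inv_smul_mem, inv_inv] at hxA
    have : f₀ • x ∈ f₀ • Z P ∩ A := ⟨Set.smul_mem_smul_set hx, hxA⟩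
    rw [hout f₀ hf₀ hf₀P] at this
    exact this
  have hd : ((S * F : Finset G) : Set G).PairwiseDisjoint (fun h => h • Z P) :=
    hV₁d.mono fun h => Set.smul_set_mono Set.inter_subset_left
  rw [Finset.coe_mul] at hd
  have hFSF : (P : Set G) ⊆ (S : Set G) * (F : Set G) := fun f hf =>
    ⟨1, hSone, f, hPF hf, one_mul f⟩
  have hsum : ∑ f ∈ F, μ ((f • Z P) ∩ A) = μ ((P : Set G) • Z P) := by
    rw [measure_finset_smul (hZ P) (hd.subset hFSF), ← Finset.sum_subset hPF]
    · exact Finset.sum_congr rfl fun f hf => by rw [Set.inter_eq_left.2 (hin f hf)]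
    · intro f hf hfP
      rw [hout f hf hfP, measure_empty]
  have hmpos : 0 < μ ((P : Set G) • Z P) := by
    rw [pos_iff_ne_zero, ne_eq, ← hnull f₀ _ (hZ P)] at hPpos
    exact (pos_iff_ne_zero.2 hPpos).trans_le (measure_mono (Set.smul_set_subset_smul hf₀P))
  refine ⟨P, Z P, hZ P, ?_, hd.subset (Set.mul_subset_mul_left hPF), hmpos, ?_⟩
  · rw [← Set.iUnion_smul_set]
    exact Set.iUnion₂_subset hin
  · calc _ ≤ μ (⋃ f ∈ (S * F) \ F, (f • Z P) ∩ A) := by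
          refine measure_mono ?_
          rintro x ⟨⟨hx, hxP⟩, hxA⟩
          rw [← mul_smul] at hx
          obtain ⟨f, ⟨s, hs, f', hf', rfl⟩, v, hv, rfl⟩ := hx
          refine Set.mem_biUnion (x := s * f') (Finset.mem_sdiff.2
            ⟨Finset.mul_mem_mul hs (hPF hf'), fun hF => ?_⟩) ⟨Set.smul_mem_smul_set hv, hxA⟩
          by_cases hsP : s * f' ∈ P
          · exact hxP (Set.smul_mem_smul hsP hv)
          · have : (s * f') • v ∈ (s * f') • Z P ∩ A := ⟨Set.smul_mem_smul_set hv, hxA⟩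
            rw [hout _ hF hsP] at this
            exact this
      _ ≤ ∑ f ∈ (S * F) \ F, μ ((f • Z P) ∩ A) := measure_biUnion_finset_le _ _
      _ ≤ ENNReal.ofReal (η / 2) * ∑ f ∈ F, μ ((f • Z P) ∩ A) :=
          hYle _ (hZ P) fun x hx => (hV₁Y hx.1).1
      _ < _ := by
          rw [hsum]
          exact ENNReal.mul_lt_mul_left hmpos.ne' (measure_ne_top _ _)
            ((ENNReal.ofReal_lt_ofReal_iff hη).2 (half_lt_self hη))

lemma exists_isTowerIn_measure_le_two_mul [IsProbabilityMeasure μ] (S : Finset G) (η : ℝ≥0∞)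
    (A : Set X) : ∃ p : Finset G × Set X, IsTowerIn μ S η A p.1 p.2 ∧
      ∀ H V, IsTowerIn μ S η A H V → μ ((H : Set G) • V) ≤ 2 * μ ((p.1 : Set G) • p.2) := by
  let s : ℝ≥0∞ := ⨆ p : {p : Finset G × Set X // IsTowerIn μ S η A p.1 p.2},
    μ ((p.1.1 : Set G) • p.1.2)
  have hle : ∀ H V, IsTowerIn μ S η A H V → μ ((H : Set G) • V) ≤ s := fun H V h =>
    le_iSup (fun p : {p : Finset G × Set X // IsTowerIn μ S η A p.1 p.2} =>
      μ ((p.1.1 : Set G) • p.1.2)) ⟨(H, V), h⟩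
  by_cases hs : s = 0
  · refine ⟨(∅, ∅), ⟨MeasurableSet.empty, by simp, by simp, by simp⟩, fun H V h => ?_⟩
    exact (hle H V h).trans (hs.trans_le zero_le)
  · have hs1 : s ≤ 1 := iSup_le fun p => prob_le_one
    obtain ⟨p, hp⟩ := lt_iSup_iff.1
      (ENNReal.half_lt_self hs (ne_top_of_le_ne_top ENNReal.one_ne_top hs1))
    refine ⟨p.1, p.2, fun H V h => (hle H V h).trans ?_⟩
    rw [← ENNReal.mul_div_cancel (a := 2) (b := s) (by simp) (by simp)]
    gcongr

/-- Towers chosen greedily exhaust the space. -/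
lemma exists_seq_isTowerIn [MeasurableConstSMul G X] [IsProbabilityMeasure μ]
    (hamen : ∀ ε' : ℝ, 0 < ε' → ∀ K' : Finset G, ∃ H : Finset G, KInvariant K' ε' H)
    (hnull : ∀ (g : G) (A : Set X), MeasurableSet A → (μ (g • A) = 0 ↔ μ A = 0))
    (hfree : SetwiseFree G μ) {S : Finset G} (hSinv : ∀ s ∈ S, s⁻¹ ∈ S) (hSone : (1 : G) ∈ S)
    {η : ℝ} (hη : 0 < η) :
    ∃ (H : ℕ → Finset G) (V A : ℕ → Set X), A 0 = Set.univ ∧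
      (∀ n, A (n + 1) = A n \ (S : Set G) • (H n : Set G) • V n) ∧
      (∀ n, IsTowerIn μ S (ENNReal.ofReal η) (A n) (H n) (V n)) ∧
      Filter.Tendsto (fun n => μ (A n)) Filter.atTop (nhds 0) := by
  choose p hp hpmax using exists_isTowerIn_measure_le_two_mul (μ := μ) S (ENNReal.ofReal η)
  let A : ℕ → Set X := fun n => Nat.rec Set.univ
    (fun _ B => B \ (S : Set G) • ((p B).1 : Set G) • (p B).2) n
  let T : ℕ → Set X := fun n => ((p (A n)).1 : Set G) • (p (A n)).2
  have hsucc : ∀ n, A (n + 1) = A n \ (S : Set G) • T n := fun n => rfl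
  have hTm : ∀ n, MeasurableSet (T n) := fun n =>
    measurableSet_finset_smul _ (hp (A n)).measurableSet
  have hAm : ∀ n, MeasurableSet (A n) := by
    intro n
    induction n with
    | zero => exact MeasurableSet.univ
    | succ n ih => exact ih.diff (measurableSet_finset_smul S (hTm n))
  have hanti : Antitone A := antitone_nat_of_succ_le fun n => Set.sdiff_subset
  have hTS : ∀ n, T n ⊆ (S : Set G) • T n := fun n x hx => ⟨1, hSone, x, hx, one_smul G x⟩
  have hTd : Pairwise (Function.onFun Disjoint T) := by
    refine (pairwise_disjoint_on T).2 fun m n hmn => ?_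
    refine Set.disjoint_left.2 fun x hx hx' => ?_
    have := hanti (Nat.succ_le_of_lt hmn) ((hp (A n)).subset hx')
    exact this.2 (hTS m hx)
  have hT0 : Filter.Tendsto (fun n => μ (T n)) Filter.atTop (nhds 0) := by
    refine ENNReal.tendsto_atTop_zero_of_tsum_ne_top ?_
    rw [← measure_iUnion hTd hTm]
    exact measure_ne_top _ _
  have hlim : ∀ B, MeasurableSet B →
      Filter.Tendsto (fun n => μ (B ∩ A n)) Filter.atTop (nhds (μ (B ∩ ⋂ n, A n))) := by
    intro B hB
    rw [Set.inter_iInter]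
    exact tendsto_measure_iInter_atTop (fun n => (hB.inter (hAm n)).nullMeasurableSet)
      (fun m n h => Set.inter_subset_inter_right _ (hanti h)) ⟨0, measure_ne_top _ _⟩
  have hA0 : μ (⋂ n, A n) = 0 := by
    by_contra hne
    obtain ⟨H, V, hV, hsub, hd, hpos, hlt⟩ := exists_isTowerIn hamen hnull hfree hSinv hSone hη
      (MeasurableSet.iInter hAm) (pos_iff_ne_zero.2 hne)
    have hHV := measurableSet_finset_smul H hV
    have hev := (hlim _ ((measurableSet_finset_smul S hHV).diff hHV)).eventually_lt_const hlt
    have hT0' : Filter.Tendsto (fun n => 2 * μ (T n)) Filter.atTop (nhds 0) := by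
      simpa using ENNReal.Tendsto.const_mul hT0 (Or.inr (by simp : (2 : ℝ≥0∞) ≠ ∞))
    obtain ⟨n, hn, hn'⟩ := (hev.and (hT0'.eventually_lt_const hpos)).exists
    exact absurd (hpmax (A n) H V ⟨hV, hsub.trans (Set.iInter_subset _ _), hd, hn.le⟩)
      (not_le.2 hn')
  refine ⟨fun n => (p (A n)).1, fun n => (p (A n)).2, A, rfl, hsucc, fun n => hp (A n), ?_⟩
  simpa [hA0] using hlim Set.univ MeasurableSet.univ

lemma exists_separated_towers [MeasurableConstSMul G X] [IsProbabilityMeasure μ]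
    (hamen : ∀ ε' : ℝ, 0 < ε' → ∀ K' : Finset G, ∃ H : Finset G, KInvariant K' ε' H)
    (hnull : ∀ (g : G) (A : Set X), MeasurableSet A → (μ (g • A) = 0 ↔ μ A = 0))
    (hfree : SetwiseFree G μ) {S : Finset G} (hSinv : ∀ s ∈ S, s⁻¹ ∈ S) (hSone : (1 : G) ∈ S)
    {η : ℝ} (hη : 0 < η) :
    ∃ (N : ℕ) (H : Fin N → Finset G) (V : Fin N → Set X), (∀ i, MeasurableSet (V i)) ∧
      (∀ i, ((S : Set G) * (H i : Set G)).PairwiseDisjoint (fun h => h • V i)) ∧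
      (∀ i j, i ≠ j → Disjoint ((S : Set G) • (H i : Set G) • V i) ((H j : Set G) • V j)) ∧
      μ (⋃ i, (H i : Set G) • V i)ᶜ ≤ ENNReal.ofReal η := by
  obtain ⟨H, V, A, hA0, hA, htower, hlim⟩ :=
    exists_seq_isTowerIn hamen hnull hfree hSinv hSone (half_pos hη)
  have hanti : Antitone A := antitone_nat_of_succ_le fun n => by
    rw [hA]; exact Set.sdiff_subset
  have hlt : ∀ m n, m < n → Disjoint ((S : Set G) • (H m : Set G) • V m)
      ((H n : Set G) • V n) := by
    refine fun m n hmn => Set.disjoint_left.2 fun x hx hx' => ?_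
    have := hanti (Nat.succ_le_of_lt hmn) ((htower n).subset hx')
    rw [Nat.succ_eq_add_one, hA] at this
    exact this.2 hx
  have hsep : ∀ m n, m ≠ n → Disjoint ((S : Set G) • (H m : Set G) • V m)
      ((H n : Set G) • V n) := by
    intro m n hmn
    rcases hmn.lt_or_gt with h | h
    · exact hlt m n h
    · refine Set.disjoint_left.2 ?_
      rintro _ ⟨s, hs, x, hx, rfl⟩ hx'
      refine Set.disjoint_left.1 (hlt n m h) ⟨s⁻¹, hSinv s hs, _, hx', inv_smul_smul s x⟩ hx
  have hself : ∀ n, (H n : Set G) • V n ⊆ (S : Set G) • (H n : Set G) • V n :=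
    fun n x hx => ⟨1, hSone, x, hx, one_smul G x⟩
  have hm : ∀ n, MeasurableSet ((H n : Set G) • V n) := fun n =>
    measurableSet_finset_smul _ (htower n).measurableSet
  obtain ⟨N, hN⟩ := (hlim.eventually_lt_const
    (ENNReal.ofReal_pos.2 (half_pos hη))).exists
  refine ⟨N, fun i => H i, fun i => V i, fun i => (htower i).measurableSet,
    fun i => (htower i).pairwiseDisjoint, fun i j hij => hsep i j (Fin.val_ne_of_ne hij), ?_⟩
  have hcover : ∀ n x, x ∉ A n → ∃ i < n, x ∈ A i ∧
      x ∈ (S : Set G) • (H i : Set G) • V i := by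
    intro n x hx
    induction n with
    | zero => exact absurd (Set.mem_univ x) (hA0 ▸ hx)
    | succ n ih =>
      by_cases hxn : x ∈ A n
      · refine ⟨n, n.lt_succ_self, hxn, ?_⟩
        by_contra h
        exact hx (hA n ▸ ⟨hxn, h⟩)
      · obtain ⟨i, hi, h⟩ := ih hxn
        exact ⟨i, hi.trans n.lt_succ_self, h⟩
  calc _ ≤ μ (A N ∪ ⋃ i : Fin N,
        ((S : Set G) • (H i : Set G) • V i \ (H i : Set G) • V i) ∩ A i) := by
        refine measure_mono fun x hx => ?_
        by_cases hxN : x ∈ A N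
        · exact Or.inl hxN
        · obtain ⟨i, hi, hxi, hxS⟩ := hcover N x hxN
          exact Or.inr (Set.mem_iUnion.2 ⟨⟨i, hi⟩,
            ⟨hxS, fun h => hx (Set.mem_iUnion.2 ⟨⟨i, hi⟩, h⟩)⟩, hxi⟩)
    _ ≤ μ (A N) + ∑ i : Fin N,
        μ (((S : Set G) • (H i : Set G) • V i \ (H i : Set G) • V i) ∩ A i) :=
        (measure_union_le _ _).trans (add_le_add_right (measure_iUnion_fintype_le _ _) _)
    _ ≤ ENNReal.ofReal (η / 2) + ∑ i : Fin N,
        ENNReal.ofReal (η / 2) * μ ((H i : Set G) • V i) :=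
        add_le_add hN.le (Finset.sum_le_sum fun i _ => (htower i).measure_le)
    _ = ENNReal.ofReal (η / 2) +
        ENNReal.ofReal (η / 2) * μ (⋃ i : Fin N, (H i : Set G) • V i) := by
        rw [← Finset.mul_sum, measure_iUnion (f := fun i : Fin N => (H i : Set G) • V i)
          (fun i j hij => (hsep i j (Fin.val_ne_of_ne hij)).mono_left (hself i))
          (fun i => hm i), tsum_fintype]
    _ ≤ ENNReal.ofReal (η / 2) + ENNReal.ofReal (η / 2) * 1 := by
        gcongr
        exact prob_le_one
    _ = ENNReal.ofReal η := by
        rw [mul_one, ← ENNReal.ofReal_add (by positivity) (by positivity), add_halves]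

lemma exists_pos_sum_measure_smul_lt [MeasurableConstSMul G X] [IsFiniteMeasure μ]
    (hnull : ∀ (g : G) (A : Set X), MeasurableSet A → (μ (g • A) = 0 ↔ μ A = 0))
    (S : Finset G) {ε : ℝ≥0∞} (hε : 0 < ε) :
    ∃ η : ℝ, 0 < η ∧ ∀ U, MeasurableSet U → μ U ≤ ENNReal.ofReal η →
      ∑ s ∈ S, μ (s • U) < ε := by
  let ν : Measure X := ∑ s ∈ S, μ.map (fun x => s⁻¹ • x)
  have hν : ∀ U, MeasurableSet U → ν U = ∑ s ∈ S, μ (s • U) := by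
    intro U hU
    simp only [ν, Measure.finsetSum_apply]
    refine Finset.sum_congr rfl fun s _ => ?_
    rw [Measure.map_apply (measurable_const_smul _) hU, Set.preimage_smul, inv_inv]
  have : IsFiniteMeasure ν := ⟨by
    rw [hν _ MeasurableSet.univ]
    exact ENNReal.sum_lt_top.2 fun s _ => measure_lt_top _ _⟩
  have hac : ν ≪ μ := Measure.AbsolutelyContinuous.mk fun U hU h0 => by
    rw [hν U hU]
    exact Finset.sum_eq_zero fun s _ => (hnull s U hU).2 h0
  obtain ⟨c, hc, h⟩ := exists_pos_setLIntegral_lt_of_measure_lt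
    (Measure.lintegral_rnDeriv_lt_top ν μ).ne hε.ne'
  obtain ⟨r, hr, hrc⟩ := ENNReal.lt_iff_exists_real_btwn.1 hc
  refine ⟨r, ENNReal.ofReal_pos.1 hrc.1, fun U hU hle => ?_⟩
  rw [← hν U hU, ← Measure.setLIntegral_rnDeriv hac]
  exact h U (hle.trans_lt hrc.2)

end Towers

section Tilings

variable {G : Type*} [Group G]

lemma finite_kBoundary (K H : Finset G) : (kBoundary (K : Set G) (H : Set G)).Finite := by
  classical
  refine (K⁻¹ * H).finite_toSet.subset ?_
  rintro g ⟨⟨k, hk, hkg⟩, -⟩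
  exact Finset.mem_mul.2 ⟨k⁻¹, Finset.inv_mem_inv hk, k * g, hkg, by simp⟩

lemma sum_card_mul_card_le [DecidableEq G] {𝒯 : Finset (Finset G)} {C : Finset G → Set G}
    (h𝒯 : IsTilingFamily 𝒯 C) (N : Finset G → Finset G) (hN : ∀ T ∈ 𝒯, (N T : Set G) ⊆ C T)
    (Q : Finset G) (hQ : ∀ T ∈ 𝒯, T * N T ⊆ Q) : ∑ T ∈ 𝒯, T.card * (N T).card ≤ Q.card := by
  have hcard : ((𝒯.sigma N).biUnion fun p => p.1.image (· * p.2)).card =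
      ∑ T ∈ 𝒯, T.card * (N T).card := by
    rw [Finset.card_biUnion, Finset.sum_sigma]
    · refine Finset.sum_congr rfl fun T _ => ?_
      simp only [Finset.card_image_of_injective _ (mul_left_injective _), Finset.sum_const,
        smul_eq_mul, mul_comm]
    · rintro ⟨T, c⟩ hp ⟨T', c'⟩ hp' hne
      rw [Finset.mem_coe, Finset.mem_sigma] at hp hp'
      have := h𝒯.1 T hp.1 c (hN T hp.1 hp.2) T' hp'.1 c' (hN T' hp'.1 hp'.2)
        (fun h => hne (by cases h; rfl))
      simp only [Function.onFun]
      rw [← Finset.disjoint_coe, Finset.coe_image, Finset.coe_image]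
      exact this
  rw [← hcard]
  refine Finset.card_le_card (Finset.biUnion_subset.2 ?_)
  rintro ⟨T, c⟩ hp
  rw [Finset.mem_sigma] at hp
  refine Finset.image_subset_iff.2 fun t ht => hQ T hp.1 (Finset.mul_mem_mul ht hp.2)

open Classical in
/-- Averaging over translates of the tiling: some translate gives a set with relatively few
elements in each tile a small weight. -/
lemma exists_translate_sum_le
    (hamen : ∀ ε' : ℝ, 0 < ε' → ∀ K' : Finset G, ∃ H : Finset G, KInvariant K' ε' H)
    {𝒯 : Finset (Finset G)} {C : Finset G → Set G} (h𝒯 : IsTilingFamily 𝒯 C) {δ : ℝ}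
    (hδ : 0 ≤ δ) (B : Finset G → Finset G) (hB : ∀ T ∈ 𝒯, ((B T).card : ℝ) ≤ δ * T.card)
    (H : Finset G) (w : G → ℝ) (hw : ∀ h, 0 ≤ w h) :
    ∃ e : G, ∑ T ∈ 𝒯, ∑ b ∈ B T, ∑ h ∈ H with b⁻¹ * h * e ∈ C T, w h ≤
      2 * δ * ∑ h ∈ H, w h := by
  let M₀ : Finset G := 𝒯.biUnion fun T => T * ((B T)⁻¹ * H)
  let M : Finset G := insert 1 (M₀ ∪ M₀⁻¹)
  have hM₀ : M₀ ⊆ M := fun x hx => Finset.mem_insert_of_mem (Finset.mem_union_left _ hx)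
  obtain ⟨E, hE⟩ := hamen 1 one_pos M
  have hME : ((M * E).card : ℝ) ≤ 2 * E.card := by
    have h1 := card_mul_sdiff_lt (S := M) (fun s hs => by
      simp only [M, Finset.mem_insert, Finset.mem_union, Finset.mem_inv'] at hs ⊢
      simpa [or_comm] using hs) (by simp [M]) hE
    have h2 : ((M * E).card : ℝ) ≤ ((M * E) \ E).card + E.card := by
      exact_mod_cast Finset.card_le_card_sdiff_add_card
    linarith
  have hEne : E.Nonempty := by
    rw [Finset.nonempty_iff_ne_empty]
    rintro rfl
    have : (0 : ℝ) ≤ (kBoundary (M : Set G) ((∅ : Finset G) : Set G)).ncard := Nat.cast_nonneg _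
    simp only [KInvariant, Finset.card_empty, Nat.cast_zero, mul_zero] at hE
    linarith
  let N : Finset G → Finset G := fun T => ((B T)⁻¹ * H * E).filter (· ∈ C T)
  have hN : ∑ T ∈ 𝒯, T.card * (N T).card ≤ (M * E).card := by
    refine sum_card_mul_card_le h𝒯 N (fun T _ c hc => (Finset.mem_filter.1 hc).2) _ ?_
    intro T hT
    calc T * N T ⊆ T * ((B T)⁻¹ * H * E) := Finset.mul_subset_mul_left (Finset.filter_subset _ _)
      _ = T * ((B T)⁻¹ * H) * E := by simp only [mul_assoc]
      _ ⊆ M * E := Finset.mul_subset_mul_right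
          ((Finset.subset_biUnion_of_mem (fun T => T * ((B T)⁻¹ * H)) hT).trans hM₀)
  have hcount : ∀ h ∈ H, ∑ T ∈ 𝒯, ∑ b ∈ B T, ((E.filter fun e => b⁻¹ * h * e ∈ C T).card : ℝ) ≤
      2 * δ * E.card := by
    intro h hh
    calc _ ≤ ∑ T ∈ 𝒯, ∑ b ∈ B T, ((N T).card : ℝ) := by
          refine Finset.sum_le_sum fun T hT => Finset.sum_le_sum fun b hb => ?_
          rw [Nat.cast_le]
          refine Finset.card_le_card_of_injOn (fun e => b⁻¹ * h * e) (fun e he => ?_)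
            (mul_right_injective _).injOn
          have he := Finset.mem_filter.1 he
          exact Finset.mem_filter.2 ⟨Finset.mul_mem_mul
            (Finset.mul_mem_mul (Finset.inv_mem_inv hb) hh) he.1, he.2⟩
      _ ≤ ∑ T ∈ 𝒯, δ * (T.card * (N T).card) := by
          refine Finset.sum_le_sum fun T hT => ?_
          rw [Finset.sum_const, nsmul_eq_mul, ← mul_assoc]
          exact mul_le_mul_of_nonneg_right (hB T hT) (Nat.cast_nonneg _)
      _ = δ * ((∑ T ∈ 𝒯, T.card * (N T).card : ℕ) : ℝ) := by
          rw [← Finset.mul_sum]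
          push_cast
          rfl
      _ ≤ δ * (2 * E.card) := by
          refine mul_le_mul_of_nonneg_left (le_trans ?_ hME) hδ
          exact_mod_cast hN
      _ = 2 * δ * E.card := by ring
  obtain ⟨e, -, he⟩ := Finset.exists_le_of_sum_le hEne
    (f := fun e => ∑ T ∈ 𝒯, ∑ b ∈ B T, ∑ h ∈ H with b⁻¹ * h * e ∈ C T, w h)
    (g := fun _ => 2 * δ * ∑ h ∈ H, w h) (by
      calc _ = ∑ h ∈ H, (∑ T ∈ 𝒯, ∑ b ∈ B T,
              ((E.filter fun e => b⁻¹ * h * e ∈ C T).card : ℝ)) * w h := by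
            simp only [Finset.sum_filter, Finset.sum_mul, Finset.card_filter, Nat.cast_sum,
              Nat.cast_ite, Nat.cast_one, Nat.cast_zero, ite_mul, one_mul, zero_mul]
            rw [Finset.sum_comm, Finset.sum_comm (s := H)]
            refine Finset.sum_congr rfl fun T _ => ?_
            rw [Finset.sum_comm, Finset.sum_comm (s := H)]
            exact Finset.sum_congr rfl fun b _ => Finset.sum_comm
        _ ≤ ∑ h ∈ H, 2 * δ * E.card * w h :=
            Finset.sum_le_sum fun h hh => mul_le_mul_of_nonneg_right (hcount h hh) (hw h)
        _ = _ := by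
            rw [← Finset.mul_sum, Finset.sum_const, nsmul_eq_mul]
            ring)
  exact ⟨e, he⟩

end Tilings

/-- the Ornstein–Weiss-type decomposition for non-singular setwise free
actions of a countable amenable group, with a tiling family of `(K, δ)`-invariant shapes,
keeping the boundaries small. -/
theorem exists_decomposition_of_tilingFamily {G X : Type*} [Group G] [Countable G]
    [MulAction G X] [MeasurableSpace X] (μ : Measure X) [IsProbabilityMeasure μ]
    (hamen : ∀ ε' : ℝ, 0 < ε' → ∀ K' : Finset G, ∃ H : Finset G, KInvariant K' ε' H)
    (ε δ : ℝ) (hε0 : 0 < ε) (hε1 : ε < 1) (hδ0 : 0 < δ) (hδ : δ < ε ^ 3 / 250)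
    (hns : NonSingularAction G μ) (hfree : SetwiseFree G μ)
    (K : Finset G) (hKsymm : ∀ k ∈ K, k⁻¹ ∈ K) (hKone : (1 : G) ∈ K)
    (𝒯 : Finset (Finset G)) (C : Finset G → Set G) (h𝒯 : IsTilingFamily 𝒯 C)
    (hinv : ∀ T ∈ 𝒯, KInvariant K δ T) :
    ∃ W : Finset G → Set X,
      (∀ T ∈ 𝒯, MeasurableSet (W T) ∧ IsHSet μ (T : Set G) (W T)) ∧
      (∀ T₁ ∈ 𝒯, ∀ T₂ ∈ 𝒯, T₁ ≠ T₂ →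
        μ ((⋃ t ∈ T₁, t • W T₁) ∩ ⋃ t ∈ T₂, t • W T₂) = 0) ∧
      ENNReal.ofReal (1 - ε) < μ (⋃ T ∈ 𝒯, ⋃ t ∈ T, t • W T) ∧
      ∑ T ∈ 𝒯, μ (⋃ g ∈ kBoundary (K : Set G) (T : Set G), g • W T) < ENNReal.ofReal ε := by
  classical
  have : MeasurableConstSMul G X := ⟨hns.1⟩
  have hnull : ∀ (g : G) (A : Set X), MeasurableSet A → (μ (g • A) = 0 ↔ μ A = 0) :=
    fun g A hA => by simpa using (hns.2 g⁻¹ A hA).symm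
  let S₀ : Finset G := 𝒯.biUnion fun T => K * T * T⁻¹
  let S : Finset G := insert 1 (S₀ ∪ S₀⁻¹)
  have hSinv : ∀ s ∈ S, s⁻¹ ∈ S := fun s hs => by
    simp only [S, Finset.mem_insert, Finset.mem_union, Finset.mem_inv'] at hs ⊢
    simpa [or_comm] using hs
  have hSone : (1 : G) ∈ S := Finset.mem_insert_self _ _
  have hKTS : ∀ T ∈ 𝒯, ∀ k ∈ K, ∀ t ∈ T, ∀ t' ∈ T, k * t * t'⁻¹ ∈ S := fun T hT k hk t ht t' ht' =>
    Finset.mem_insert_of_mem (Finset.mem_union_left _ (Finset.mem_biUnion.2 ⟨T, hT,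
      Finset.mul_mem_mul (Finset.mul_mem_mul hk ht) (Finset.inv_mem_inv ht')⟩))
  obtain ⟨η, hη, hηS⟩ := exists_pos_sum_measure_smul_lt hnull S (ENNReal.ofReal_pos.2 hε0)
  obtain ⟨N, H, V, hV, hd, hsep, hU⟩ :=
    exists_separated_towers hamen hnull hfree hSinv hSone hη
  have hHS : ∀ i, (H i : Set G) ⊆ (S : Set G) * (H i : Set G) := fun i h hh =>
    ⟨1, hSone, h, hh, one_mul h⟩
  have hHVS : ∀ i, (H i : Set G) • V i ⊆ (S : Set G) • (H i : Set G) • V i :=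
    fun i x hx => ⟨1, hSone, x, hx, one_smul G x⟩
  have huniq : ∀ i j s h v v', s ∈ S → h ∈ H i → v ∈ V i → v' ∈ V j →
      ∀ h' ∈ H j, (s * h) • v = h' • v' → i = j ∧ s * h = h' := by
    intro i j s h v v' hs hh hv hv' h' hh' heq
    have hij : i = j := by
      by_contra hij
      refine Set.disjoint_left.1 (hsep i j hij) (?_ : (s * h) • v ∈ _) ?_
      · rw [mul_smul]
        exact Set.smul_mem_smul hs (Set.smul_mem_smul hh hv)
      · rw [heq]
        exact Set.smul_mem_smul hh' hv'
    subst hij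
    refine ⟨rfl, ?_⟩
    by_contra hne
    refine Set.disjoint_left.1 (hd i (Set.mul_mem_mul hs hh) (hHS i hh') hne)
      (Set.smul_mem_smul_set hv) ?_
    simp only [heq]
    exact Set.smul_mem_smul_set hv'
  let B : Finset G → Finset G := fun T => (finite_kBoundary K T).toFinset
  have hB : ∀ T ∈ 𝒯, ((B T).card : ℝ) ≤ δ * T.card := fun T hT => by
    rw [← Set.ncard_eq_toFinset_card _ (finite_kBoundary K T)]
    exact (hinv T hT).le
  have htrans := fun i => exists_translate_sum_le hamen h𝒯 hδ0.le B hB (H i)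
    (fun h => μ.real (h • V i)) (fun h => measureReal_nonneg)
  choose e he using htrans
  let D : Fin N → Finset G → Set G := fun i T =>
    {d | d * e i ∈ C T ∧ ∀ k ∈ K, ∀ t ∈ T, k * t * d ∈ H i}
  have hDH : ∀ i T d t, d ∈ D i T → t ∈ T → t * d ∈ H i := fun i T d t hdD ht => by
    simpa using hdD.2 1 hKone t ht
  let W : Finset G → Set X := fun T => ⋃ i, D i T • V i
  have hWuniq : ∀ T ∈ 𝒯, ∀ T' ∈ 𝒯, ∀ t ∈ T, ∀ t' ∈ T', ∀ x, x ∈ t • W T → x ∈ t' • W T' →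
      T = T' ∧ t = t' := by
    rintro T hT T' hT' t ht t' ht' x ⟨y, hy, rfl⟩ ⟨y', hy', hyy⟩
    obtain ⟨i, d, hdD, v, hv, rfl⟩ := Set.mem_iUnion.1 hy
    obtain ⟨j, d', hdD', v', hv', rfl⟩ := Set.mem_iUnion.1 hy'
    simp only [smul_smul] at hyy
    have htd := hDH i T d t hdD ht
    obtain ⟨rfl, heq⟩ := huniq i j 1 (t * d) v v' hSone htd hv hv'
      (t' * d') (hDH j T' d' t' hdD' ht') (by rw [one_mul]; exact hyy.symm)
    rw [one_mul] at heq
    have hTd : (T, d * e i) = (T', d' * e i) := by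
      by_contra hne
      refine Set.disjoint_left.1 (h𝒯.1 T hT _ hdD.1 T' hT' _ hdD'.1 hne)
        ⟨t, ht, rfl⟩ ⟨t', ht', ?_⟩
      simp only [← mul_assoc, heq]
    obtain ⟨rfl, h⟩ := Prod.mk.inj hTd
    obtain rfl := mul_right_cancel h
    exact ⟨rfl, mul_right_cancel heq⟩
  refine ⟨W, fun T hT => ⟨?_, ?_⟩, ?_, ?_, ?_⟩
  · refine MeasurableSet.iUnion fun i => ?_
    rw [← Set.iUnion_smul_set]
    exact MeasurableSet.biUnion (Set.to_countable _) fun d _ => (hV i).const_smul d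
  · intro t ht t' ht' hne
    rw [Set.disjoint_iff_inter_eq_empty.1 (Set.disjoint_left.2 fun x hx hx' =>
      hne (hWuniq T hT T hT t ht t' ht' x hx hx').2), measure_empty]
  · intro T hT T' hT' hne
    rw [Set.disjoint_iff_inter_eq_empty.1 (Set.disjoint_left.2 fun x hx hx' => ?_), measure_empty]
    obtain ⟨t, ht, hx⟩ := Set.mem_iUnion₂.1 hx
    obtain ⟨t', ht', hx'⟩ := Set.mem_iUnion₂.1 hx'
    exact hne (hWuniq T hT T' hT' t ht t' ht' x hx hx').1
  · let U : Set X := (⋃ i, (H i : Set G) • V i)ᶜ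
    have hUm : MeasurableSet U := (MeasurableSet.iUnion fun i =>
      measurableSet_finset_smul (H i) (hV i)).compl
    have hbad : μ (⋃ s ∈ S, s • U) < ENNReal.ofReal ε :=
      (measure_biUnion_finset_le _ _).trans_lt (hηS U hUm hU)
    have hbadm : MeasurableSet (⋃ s ∈ S, s • U) :=
      S.measurableSet_biUnion fun s _ => hUm.const_smul s
    have hsub : (⋃ s ∈ S, s • U)ᶜ ⊆ ⋃ T ∈ 𝒯, ⋃ t ∈ T, t • W T := by
      intro x hx
      have hcov : ∀ s ∈ S, s • x ∈ ⋃ i, (H i : Set G) • V i := by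
        intro s hs
        by_contra h
        refine hx (Set.mem_biUnion (hSinv s hs) ?_)
        rw [Set.mem_smul_set_iff_inv_smul_mem, inv_inv]
        exact h
      have hx1 := hcov 1 hSone
      rw [one_smul] at hx1
      obtain ⟨i, h, hh, v, hv, rfl⟩ := Set.mem_iUnion.1 hx1
      have hSh : ∀ s ∈ S, s * h ∈ H i := by
        intro s hs
        obtain ⟨j, h', hh', v', hv', heq⟩ := Set.mem_iUnion.1 (hcov s hs)
        simp only [smul_smul] at heq
        obtain ⟨rfl, hsh⟩ := huniq i j s h v v' hs hh hv hv' h' hh'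
          heq.symm
        rwa [hsh]
      have huniv : h * e i ∈ ⋃ T ∈ 𝒯, ⋃ c ∈ C T, (fun t => t * c) '' (T : Set G) := by
        rw [h𝒯.2]
        trivial
      simp only [Set.mem_iUnion] at huniv
      obtain ⟨T, hT, c, hc, t, ht, htc⟩ := huniv
      simp only at htc
      refine Set.mem_biUnion hT (Set.mem_biUnion ht ?_)
      refine ⟨(t⁻¹ * h) • v, Set.mem_iUnion.2 ⟨i, Set.smul_mem_smul ⟨?_, ?_⟩ hv⟩, ?_⟩
      · rw [mul_assoc, ← htc, inv_mul_cancel_left]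
        exact hc
      · intro k hk t' ht'
        rw [← mul_assoc]
        exact hSh _ (hKTS T hT k hk t' ht' t ht)
      · simp only [smul_smul, mul_inv_cancel_left]
    refine lt_of_lt_of_le ?_ (measure_mono hsub)
    rw [← ofReal_measureReal, probReal_compl_eq_one_sub hbadm]
    have hlt : μ.real (⋃ s ∈ S, s • U) < ε := by
      rwa [← ENNReal.ofReal_lt_ofReal_iff hε0, ofReal_measureReal (measure_ne_top _ _)]
    exact (ENNReal.ofReal_lt_ofReal_iff (by linarith)).2 (by linarith)
  · have hWb : ∀ T ∈ 𝒯, μ (⋃ g ∈ kBoundary (K : Set G) (T : Set G), g • W T) ≤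
        ∑ b ∈ B T, ∑ i, ∑ h ∈ H i with b⁻¹ * h * e i ∈ C T, μ (h • V i) := by
      intro T hT
      calc _ ≤ μ (⋃ b ∈ B T, ⋃ i, ⋃ h ∈ (H i).filter fun h => b⁻¹ * h * e i ∈ C T, h • V i) := by
            refine measure_mono fun x hx => ?_
            obtain ⟨b, hb, y, hy, rfl⟩ := Set.mem_iUnion₂.1 hx
            obtain ⟨i, d, hdD, v, hv, rfl⟩ := Set.mem_iUnion.1 hy
            refine Set.mem_biUnion (x := b) ((Set.Finite.mem_toFinset _).2 hb)
              (Set.mem_iUnion.2 ⟨i, Set.mem_biUnion (x := b * d) (Finset.mem_filter.2 ⟨?_, ?_⟩)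
                ⟨v, hv, mul_smul _ _ _⟩⟩)
            · obtain ⟨⟨k, hk, hkb⟩, -⟩ := hb
              simpa using hdD.2 k⁻¹ (hKsymm k hk) (k * b) hkb
            · rw [inv_mul_cancel_left]
              exact hdD.1
        _ ≤ _ := (measure_biUnion_finset_le _ _).trans (Finset.sum_le_sum fun b _ =>
            (measure_iUnion_fintype_le _ _).trans (Finset.sum_le_sum fun i _ =>
              measure_biUnion_finset_le _ _))
    refine (Finset.sum_le_sum hWb).trans_lt ?_
    have hreal : ∑ T ∈ 𝒯, ∑ b ∈ B T, ∑ i, ∑ h ∈ H i with b⁻¹ * h * e i ∈ C T, μ (h • V i) =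
        ENNReal.ofReal (∑ T ∈ 𝒯, ∑ b ∈ B T, ∑ i, ∑ h ∈ H i with b⁻¹ * h * e i ∈ C T,
          μ.real (h • V i)) := by
      simp (discharger := intros; positivity) only [ENNReal.ofReal_sum_of_nonneg]
      exact Finset.sum_congr rfl fun T _ => Finset.sum_congr rfl fun b _ => Finset.sum_congr rfl
        fun i _ => Finset.sum_congr rfl fun h _ => (ofReal_measureReal (measure_ne_top _ _)).symm
    have hmass : ∑ i, ∑ h ∈ H i, μ.real (h • V i) ≤ 1 := by
      have h1 : ∀ i, ∑ h ∈ H i, μ.real (h • V i) = μ.real ((H i : Set G) • V i) := fun i => by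
        rw [measureReal_def, measure_finset_smul (hV i) ((hd i).subset (hHS i)),
          ENNReal.toReal_sum fun _ _ => measure_ne_top _ _]
        rfl
      simp only [h1]
      rw [← measureReal_biUnion_finset (fun i _ j _ hij => (hsep i j hij).mono_left (hHVS i))
        fun i _ => measurableSet_finset_smul (H i) (hV i)]
      exact measureReal_le_one
    rw [hreal, ENNReal.ofReal_lt_ofReal_iff hε0]
    calc _ = ∑ i, ∑ T ∈ 𝒯, ∑ b ∈ B T, ∑ h ∈ H i with b⁻¹ * h * e i ∈ C T,
          μ.real (h • V i) := by
          rw [Finset.sum_comm (s := Finset.univ)]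
          exact Finset.sum_congr rfl fun T _ => Finset.sum_comm
      _ ≤ ∑ i, 2 * δ * ∑ h ∈ H i, μ.real (h • V i) := Finset.sum_le_sum fun i _ => he i
      _ ≤ 2 * δ * 1 := by
          rw [← Finset.mul_sum]
          exact mul_le_mul_of_nonneg_left hmass (by positivity)
      _ < ε := by
          have : ε ^ 3 ≤ ε := pow_le_of_le_one hε0.le hε1.le (by norm_num)
          linarith
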